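/- For all x, y, z ∈ W, one has x ▷ y ≤ z in Bruhat order if and only if y ≤ x⁻¹ ∗ z. -/

import Mathlib

/-! Common setup: a finite Coxeter system, Bruhat order, and the sets
`{u * y : u ≤ x}` and `{x * v : v ≤ y}` used to characterize the
Demazure product `∗` and the operations `▷`, `◁`. -/

/-- The Bruhat order on a Coxeter group: the reflexive-transitive closure of
the relation `u → u * t`, where `t` is a reflection and right multiplication
by `t` increases length. -/
def CoxeterSystem.bruhatLE {B W : Type*} [Group W] {M : CoxeterMatrix B}
    (cs : CoxeterSystem M W) : W → W → Prop :=
  Relation.ReflTransGen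
    (fun u v => ∃ t, cs.IsReflection t ∧ v = u * t ∧ cs.length u < cs.length v)

/-- The set `{u * y : u ∈ W, u ≤ x}`. -/
def CoxeterSystem.lset {B W : Type*} [Group W] {M : CoxeterMatrix B}
    (cs : CoxeterSystem M W) (x y : W) : Set W :=
  {z | ∃ u, cs.bruhatLE u x ∧ z = u * y}

/-- The set `{x * v : v ∈ W, v ≤ y}`. -/
def CoxeterSystem.rset {B W : Type*} [Group W] {M : CoxeterMatrix B}
    (cs : CoxeterSystem M W) (x y : W) : Set W :=
  {z | ∃ v, cs.bruhatLE v y ∧ z = x * v}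

namespace CoxeterSystem

variable {B W : Type*} [Group W] {M : CoxeterMatrix B} (cs : CoxeterSystem M W)

/-! ### The reflection cocycle -/

open Classical in
/-- The action of a simple reflection on signed elements: conjugation, together with a change of
sign exactly at the simple reflection itself. -/
noncomputable def signedConj (i : B) : Equiv.Perm (W × ZMod 2) :=
  Function.Involutive.toPerm
    (fun p => (cs.simple i * p.1 * cs.simple i, p.2 + if p.1 = cs.simple i then 1 else 0)) <| by
    rintro ⟨t, ε⟩
    have h : cs.simple i * t * cs.simple i = cs.simple i ↔ t = cs.simple i := by
      rw [mul_eq_right, mul_eq_one_iff_inv_eq, cs.inv_simple, eq_comm]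
    ext1
    · simp [mul_assoc]
    · simp [h, add_assoc, ← two_mul, show (2 : ZMod 2) = 0 from rfl]

open Classical in
theorem signedConj_apply (i : B) (p : W × ZMod 2) :
    cs.signedConj i p =
      (cs.simple i * p.1 * cs.simple i, p.2 + if p.1 = cs.simple i then 1 else 0) := rfl

open Classical in
theorem signedConj_mul_pow_apply (i j : B) (k : ℕ) (t : W) (ε : ZMod 2) :
    ((cs.signedConj i * cs.signedConj j) ^ k) (t, ε) =
      ((cs.simple i * cs.simple j) ^ k * t * ((cs.simple i * cs.simple j) ^ k)⁻¹,
        ε + ∑ n ∈ Finset.range (2 * k),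
          if t = cs.simple j * (cs.simple i * cs.simple j) ^ n then 1 else 0) := by
  set p := cs.simple i * cs.simple j with hp
  have hpinv : p⁻¹ = cs.simple j * cs.simple i := by simp [hp]
  have hconj (n : ℕ) : cs.simple j * p ^ n = (p ^ n)⁻¹ * cs.simple j := by
    have h : SemiconjBy (cs.simple j) p p⁻¹ := by simp [SemiconjBy, hp, mul_assoc]
    simpa using (h.pow_right n).eq
  induction k with
  | zero => simp
  | succ k ih =>
    rw [pow_succ', Equiv.Perm.mul_apply, ih, Equiv.Perm.mul_apply, signedConj_apply,
      signedConj_apply]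
    have h1 : p ^ k * t * (p ^ k)⁻¹ = cs.simple j ↔ t = cs.simple j * p ^ (2 * k) := by
      rw [two_mul, pow_add, ← mul_assoc, hconj, mul_inv_eq_iff_eq_mul, mul_assoc,
        eq_inv_mul_iff_mul_eq]
    have h2 : cs.simple j * (p ^ k * t * (p ^ k)⁻¹) * cs.simple j = cs.simple i ↔
        t = cs.simple j * p ^ (2 * k + 1) := by
      have e : cs.simple j * p ^ (2 * k + 1) =
          (p ^ k)⁻¹ * (cs.simple j * cs.simple i * cs.simple j) * p ^ k := by
        rw [show 2 * k + 1 = k + (1 + k) by ring, pow_add, ← mul_assoc, hconj, pow_add, pow_one, hp]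
        simp only [mul_assoc]
      rw [e]
      constructor
      · intro h
        rw [← h]
        simp [mul_assoc]
      · rintro rfl
        simp [mul_assoc]
    rw [show 2 * (k + 1) = 2 * k + 1 + 1 by ring, Finset.sum_range_succ, Finset.sum_range_succ]
    simp only [h1, h2, add_assoc, Prod.mk.injEq, and_true]
    rw [pow_succ', mul_inv_rev, hpinv, hp]
    simp only [mul_assoc]

theorem isLiftable_signedConj : M.IsLiftable cs.signedConj := by
  classical
  intro i j
  ext1 ⟨t, ε⟩
  rw [signedConj_mul_pow_apply, two_mul, Finset.sum_range_add]
  simp only [pow_add, cs.simple_mul_simple_pow, one_mul, inv_one, mul_one, CharTwo.add_self_eq_zero,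
    add_zero, Equiv.Perm.one_apply]

/-- The action of a Coxeter group on signed elements extending `signedConj`. -/
noncomputable def signedConjHom : W →* Equiv.Perm (W × ZMod 2) :=
  cs.lift ⟨cs.signedConj, cs.isLiftable_signedConj⟩

theorem signedConjHom_simple (i : B) : cs.signedConjHom (cs.simple i) = cs.signedConj i :=
  cs.lift_apply_simple cs.isLiftable_signedConj i

/-- The sign change of `t` under the action of `w`; on reflections it detects right inversions. -/
noncomputable def reflectionCocycle (w t : W) : ZMod 2 := (cs.signedConjHom w (t, 0)).2

theorem signedConjHom_apply (w t : W) (ε : ZMod 2) :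
    cs.signedConjHom w (t, ε) = (w * t * w⁻¹, ε + cs.reflectionCocycle w t) := by
  induction w using cs.simple_induction_left generalizing ε with
  | one => simp [reflectionCocycle]
  | mul_simple_left w i ih =>
    rw [reflectionCocycle, map_mul, Equiv.Perm.mul_apply, Equiv.Perm.mul_apply, ih, ih,
      signedConjHom_simple, signedConj_apply, signedConj_apply]
    simp [mul_assoc, add_assoc]

theorem reflectionCocycle_mul (v w t : W) :
    cs.reflectionCocycle (v * w) t =
      cs.reflectionCocycle w t + cs.reflectionCocycle v (w * t * w⁻¹) := by
  rw [reflectionCocycle, map_mul, Equiv.Perm.mul_apply, signedConjHom_apply, signedConjHom_apply]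
  simp

theorem reflectionCocycle_one (t : W) : cs.reflectionCocycle 1 t = 0 := by
  simp [reflectionCocycle]

open Classical in
theorem reflectionCocycle_simple (i : B) (t : W) :
    cs.reflectionCocycle (cs.simple i) t = if t = cs.simple i then 1 else 0 := by
  simp [reflectionCocycle, signedConjHom_simple, signedConj_apply]

variable {cs} in
theorem IsReflection.reflectionCocycle_self {t : W} (ht : cs.IsReflection t) :
    cs.reflectionCocycle t t = 1 := by
  obtain ⟨u, i, rfl⟩ := ht
  have h := cs.reflectionCocycle_mul u u⁻¹ (u * cs.simple i * u⁻¹)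
  have e : u⁻¹ * (u * cs.simple i * u⁻¹) * u⁻¹⁻¹ = cs.simple i := by simp [mul_assoc]
  rw [mul_inv_cancel, reflectionCocycle_one, e] at h
  rw [reflectionCocycle_mul, reflectionCocycle_mul _ u, e, reflectionCocycle_simple, if_pos rfl]
  simp only [inv_simple, simple_mul_simple_self, one_mul]
  rw [add_comm 1, ← add_assoc, ← h, zero_add]

theorem mem_rightInvSeq_of_reflectionCocycle_ne_zero (ω : List B) (t : W)
    (h : cs.reflectionCocycle (cs.wordProd ω) t ≠ 0) : t ∈ cs.rightInvSeq ω := by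
  classical
  induction ω with
  | nil => simp [reflectionCocycle_one] at h
  | cons i ω ih =>
    rw [wordProd_cons, reflectionCocycle_mul, reflectionCocycle_simple] at h
    rw [rightInvSeq, List.mem_cons]
    by_cases ht : cs.wordProd ω * t * (cs.wordProd ω)⁻¹ = cs.simple i
    · left
      rw [← ht]
      simp [mul_assoc]
    · right
      exact ih (by simpa [ht] using h)

theorem length_mul_lt_of_reflectionCocycle_ne_zero {w t : W}
    (h : cs.reflectionCocycle w t ≠ 0) : cs.length (w * t) < cs.length w := by
  obtain ⟨ω, hω, rfl⟩ := cs.exists_isReduced w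
  exact (cs.isRightInversion_of_mem_rightInvSeq hω
    (cs.mem_rightInvSeq_of_reflectionCocycle_ne_zero ω t h)).2

variable {cs} in
theorem IsReflection.reflectionCocycle_eq_zero_iff {t : W} (ht : cs.IsReflection t) (w : W) :
    cs.reflectionCocycle w t = 0 ↔ cs.length w < cs.length (w * t) := by
  constructor
  · intro h
    have h' : cs.reflectionCocycle (w * t) t ≠ 0 := by
      rw [reflectionCocycle_mul, ht.reflectionCocycle_self]
      simp [h]
    simpa [mul_assoc, ht.mul_self] using cs.length_mul_lt_of_reflectionCocycle_ne_zero h'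
  · intro h
    by_contra h'
    exact lt_asymm h (cs.length_mul_lt_of_reflectionCocycle_ne_zero h')

variable {cs} in
theorem IsReflection.simple_mul_eq_or_length_lt {t : W} (ht : cs.IsReflection t) {w : W}
    (h : cs.length w < cs.length (w * t)) (i : B) :
    cs.simple i * w = w * t ∨ cs.length (cs.simple i * w) < cs.length (cs.simple i * w * t) := by
  classical
  rw [← ht.reflectionCocycle_eq_zero_iff] at h ⊢
  rw [reflectionCocycle_mul, h, reflectionCocycle_simple, zero_add]
  by_cases hi : w * t * w⁻¹ = cs.simple i
  · left
    simp [← hi]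
  · right
    simp [hi]

/-! ### Simple reflections and the Bruhat order -/

variable {cs}

theorem bruhatLE.trans {u v w : W} (huv : cs.bruhatLE u v) (hvw : cs.bruhatLE v w) :
    cs.bruhatLE u w :=
  Relation.ReflTransGen.trans huv hvw

variable (cs)

theorem bruhatLE_refl (w : W) : cs.bruhatLE w w := Relation.ReflTransGen.refl

variable {cs} in
theorem IsReflection.bruhatLE_mul {t : W} (ht : cs.IsReflection t) {w : W}
    (h : cs.length w < cs.length (w * t)) : cs.bruhatLE w (w * t) :=
  Relation.ReflTransGen.single ⟨t, ht, rfl, h⟩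

theorem bruhatLE_simple_mul {i : B} {w : W} (h : cs.length w < cs.length (cs.simple i * w)) :
    cs.bruhatLE w (cs.simple i * w) := by
  have e : w * (w⁻¹ * cs.simple i * w⁻¹⁻¹) = cs.simple i * w := by simp [mul_assoc]
  rw [← e] at h ⊢
  exact ((cs.isReflection_simple i).conj w⁻¹).bruhatLE_mul h

theorem simple_mul_bruhatLE {i : B} {w : W} (h : cs.length (cs.simple i * w) < cs.length w) :
    cs.bruhatLE (cs.simple i * w) w := by
  have h' := cs.bruhatLE_simple_mul (i := i) (w := cs.simple i * w)
  rw [simple_mul_simple_cancel_left] at h'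
  exact h' h

/-- The larger of `w` and `s i * w`. -/
noncomputable def simpleMax (i : B) (w : W) : W :=
  if cs.length w < cs.length (cs.simple i * w) then cs.simple i * w else w

/-- The smaller of `w` and `s i * w`. -/
noncomputable def simpleMin (i : B) (w : W) : W :=
  if cs.length w < cs.length (cs.simple i * w) then w else cs.simple i * w

theorem length_simple_mul_lt_of_not_lt {i : B} {w : W}
    (h : ¬ cs.length w < cs.length (cs.simple i * w)) :
    cs.length (cs.simple i * w) < cs.length w :=
  lt_of_le_of_ne (not_lt.mp h) (cs.length_simple_mul_ne w i)

theorem bruhatLE_simpleMax (i : B) (w : W) : cs.bruhatLE w (cs.simpleMax i w) := by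
  unfold simpleMax
  split_ifs with h
  · exact cs.bruhatLE_simple_mul h
  · exact cs.bruhatLE_refl w

theorem simple_mul_bruhatLE_simpleMax (i : B) (w : W) :
    cs.bruhatLE (cs.simple i * w) (cs.simpleMax i w) := by
  unfold simpleMax
  split_ifs with h
  · exact cs.bruhatLE_refl _
  · exact cs.simple_mul_bruhatLE (cs.length_simple_mul_lt_of_not_lt h)

theorem simpleMin_bruhatLE (i : B) (w : W) : cs.bruhatLE (cs.simpleMin i w) w := by
  unfold simpleMin
  split_ifs with h
  · exact cs.bruhatLE_refl w
  · exact cs.simple_mul_bruhatLE (cs.length_simple_mul_lt_of_not_lt h)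

theorem simpleMin_bruhatLE_simple_mul (i : B) (w : W) :
    cs.bruhatLE (cs.simpleMin i w) (cs.simple i * w) := by
  unfold simpleMin
  split_ifs with h
  · exact cs.bruhatLE_simple_mul h
  · exact cs.bruhatLE_refl _

theorem simpleMax_eq_or (i : B) (w : W) :
    cs.simpleMax i w = w ∨ cs.simpleMax i w = cs.simple i * w := by
  unfold simpleMax
  split_ifs <;> simp

theorem simpleMin_eq_or (i : B) (w : W) :
    cs.simpleMin i w = w ∨ cs.simpleMin i w = cs.simple i * w := by
  unfold simpleMin
  split_ifs <;> simp

variable {cs}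

theorem bruhatLE.simpleMax {v w : W} (h : cs.bruhatLE v w) (i : B) :
    cs.bruhatLE (cs.simpleMax i v) (cs.simpleMax i w) := by
  induction h with
  | refl => exact cs.bruhatLE_refl _
  | @tail a b _ hab ih =>
    refine ih.trans ?_
    obtain ⟨t, ht, rfl, hlt⟩ := hab
    rcases cs.simpleMax_eq_or i a with h | h <;> rw [h]
    · exact (ht.bruhatLE_mul hlt).trans (cs.bruhatLE_simpleMax i _)
    · rcases ht.simple_mul_eq_or_length_lt hlt i with h' | h'
      · rw [h']
        exact cs.bruhatLE_simpleMax i _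
      · refine (ht.bruhatLE_mul h').trans ?_
        rw [mul_assoc]
        exact cs.simple_mul_bruhatLE_simpleMax i _

theorem bruhatLE.simpleMin {v w : W} (h : cs.bruhatLE v w) (i : B) :
    cs.bruhatLE (cs.simpleMin i v) (cs.simpleMin i w) := by
  induction h with
  | refl => exact cs.bruhatLE_refl _
  | @tail a b _ hab ih =>
    refine ih.trans ?_
    obtain ⟨t, ht, rfl, hlt⟩ := hab
    rcases cs.simpleMin_eq_or i (a * t) with h | h <;> rw [h]
    · exact (cs.simpleMin_bruhatLE i _).trans (ht.bruhatLE_mul hlt)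
    · rcases ht.simple_mul_eq_or_length_lt hlt i with h' | h'
      · rw [← h', simple_mul_simple_cancel_left]
        exact cs.simpleMin_bruhatLE i _
      · refine (cs.simpleMin_bruhatLE_simple_mul i _).trans ?_
        rw [← mul_assoc]
        exact ht.bruhatLE_mul h'

variable (cs)

theorem simpleMin_bruhatLE_iff (i : B) (y z : W) :
    cs.bruhatLE (cs.simpleMin i y) z ↔ cs.bruhatLE y (cs.simpleMax i z) := by
  constructor
  · intro h
    refine bruhatLE.trans ?_ (h.simpleMax i)
    rcases cs.simpleMin_eq_or i y with e | e <;> rw [e]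
    · exact cs.bruhatLE_simpleMax i y
    · simpa using cs.simple_mul_bruhatLE_simpleMax i (cs.simple i * y)
  · intro h
    refine (h.simpleMin i).trans ?_
    rcases cs.simpleMax_eq_or i z with e | e <;> rw [e]
    · exact cs.simpleMin_bruhatLE i z
    · simpa using cs.simpleMin_bruhatLE_simple_mul i (cs.simple i * z)

theorem foldr_simpleMin_bruhatLE_iff (ω : List B) (y z : W) :
    cs.bruhatLE (ω.foldr cs.simpleMin y) z ↔ cs.bruhatLE y (ω.reverse.foldr cs.simpleMax z) := by
  induction ω generalizing z with
  | nil => rfl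
  | cons i ω ih =>
    rw [List.foldr_cons, simpleMin_bruhatLE_iff, ih, List.reverse_cons, List.foldr_append]
    rfl

theorem bruhatLE_simple_mul_iff {i : B} {x : W} (h : cs.length x < cs.length (cs.simple i * x))
    (u : W) :
    cs.bruhatLE u (cs.simple i * x) ↔ cs.bruhatLE u x ∨ cs.bruhatLE (cs.simple i * u) x := by
  have hx : cs.simpleMax i x = cs.simple i * x := if_pos h
  rw [← hx]
  constructor
  · intro hu
    rw [← simpleMin_bruhatLE_iff] at hu
    rcases cs.simpleMin_eq_or i u with e | e <;> rw [e] at hu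
    · exact Or.inl hu
    · exact Or.inr hu
  · rintro (hu | hu)
    · exact hu.trans (cs.bruhatLE_simpleMax i x)
    · refine bruhatLE.trans ?_ (hu.simpleMax i)
      simpa using cs.simple_mul_bruhatLE_simpleMax i (cs.simple i * u)

theorem bruhatLE_one_iff (u : W) : cs.bruhatLE u 1 ↔ u = 1 := by
  constructor
  · intro h
    rcases Relation.ReflTransGen.cases_tail h with h | ⟨v, _, t, _, _, hlt⟩
    · exact h.symm
    · simp at hlt
  · rintro rfl
    exact cs.bruhatLE_refl 1

/-! ### Lower Bruhat intervals through reduced words -/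

theorem lset_one (y : W) : cs.lset 1 y = {y} := by
  ext w
  simp [lset, bruhatLE_one_iff]

theorem mem_lset_simple_mul_iff {i : B} {x : W} (h : cs.length x < cs.length (cs.simple i * x))
    (y w : W) :
    w ∈ cs.lset (cs.simple i * x) y ↔ w ∈ cs.lset x y ∨ cs.simple i * w ∈ cs.lset x y := by
  have key (v : W) : v ∈ cs.lset x y ↔ cs.bruhatLE (v * y⁻¹) x :=
    ⟨by rintro ⟨u, hu, rfl⟩; simpa using hu, fun hv => ⟨_, hv, by simp⟩⟩
  rw [key, key, mul_assoc, ← cs.bruhatLE_simple_mul_iff h]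
  exact ⟨by rintro ⟨u, hu, rfl⟩; simpa using hu, fun hv => ⟨_, hv, by simp⟩⟩

variable {cs}

theorem IsReduced.of_cons {i : B} {ω : List B} (h : cs.IsReduced (i :: ω)) : cs.IsReduced ω := by
  simpa using h.drop 1

theorem IsReduced.length_lt_simple_mul {i : B} {ω : List B} (h : cs.IsReduced (i :: ω)) :
    cs.length (cs.wordProd ω) < cs.length (cs.simple i * cs.wordProd ω) := by
  rw [← wordProd_cons, h.eq, h.of_cons.eq]
  simp

theorem IsReduced.foldr_mem_lset {ω : List B} (hω : cs.IsReduced ω) {f : B → W → W}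
    (hf : ∀ i w, f i w = w ∨ f i w = cs.simple i * w) (y : W) :
    ω.foldr f y ∈ cs.lset (cs.wordProd ω) y := by
  induction ω with
  | nil => simp [lset_one]
  | cons i ω ih =>
    rw [wordProd_cons, cs.mem_lset_simple_mul_iff hω.length_lt_simple_mul, List.foldr_cons]
    rcases hf i (ω.foldr f y) with e | e <;> rw [e]
    · exact Or.inl (ih hω.of_cons)
    · right
      simpa using ih hω.of_cons

theorem IsReduced.bruhatLE_foldr_simpleMax {ω : List B} (hω : cs.IsReduced ω) {y w : W}
    (hw : w ∈ cs.lset (cs.wordProd ω) y) : cs.bruhatLE w (ω.foldr cs.simpleMax y) := by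
  induction ω generalizing w with
  | nil =>
    obtain rfl : w = y := by simpa [lset_one] using hw
    exact cs.bruhatLE_refl w
  | cons i ω ih =>
    rw [wordProd_cons, cs.mem_lset_simple_mul_iff hω.length_lt_simple_mul] at hw
    rw [List.foldr_cons]
    rcases hw with hw | hw
    · exact (ih hω.of_cons hw).trans (cs.bruhatLE_simpleMax i _)
    · refine bruhatLE.trans ?_ ((ih hω.of_cons hw).simpleMax i)
      simpa using cs.simple_mul_bruhatLE_simpleMax i (cs.simple i * w)

theorem IsReduced.foldr_simpleMin_bruhatLE {ω : List B} (hω : cs.IsReduced ω) {y w : W}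
    (hw : w ∈ cs.lset (cs.wordProd ω) y) : cs.bruhatLE (ω.foldr cs.simpleMin y) w := by
  induction ω generalizing w with
  | nil =>
    obtain rfl : w = y := by simpa [lset_one] using hw
    exact cs.bruhatLE_refl w
  | cons i ω ih =>
    rw [wordProd_cons, cs.mem_lset_simple_mul_iff hω.length_lt_simple_mul] at hw
    rw [List.foldr_cons]
    rcases hw with hw | hw
    · exact (cs.simpleMin_bruhatLE i _).trans (ih hω.of_cons hw)
    · refine ((ih hω.of_cons hw).simpleMin i).trans ?_
      simpa using cs.simpleMin_bruhatLE_simple_mul i (cs.simple i * w)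

end CoxeterSystem

/-- For all `x y z ∈ W`: `x ▷ y ≤ z` in Bruhat order iff `y ≤ x⁻¹ ∗ z`. -/
theorem rtr_le_iff {B W : Type*} [Group W] [Finite W] {M : CoxeterMatrix B}
    (cs : CoxeterSystem M W) (star rtr : W → W → W)
    (hstar : ∀ x y : W, star x y ∈ cs.lset x y ∧
      ∀ z ∈ cs.lset x y, cs.bruhatLE z (star x y))
    (hrtr : ∀ x y : W, rtr x y ∈ cs.lset x y ∧
      ∀ z ∈ cs.lset x y, cs.bruhatLE (rtr x y) z)
    (x y z : W) :
    cs.bruhatLE (rtr x y) z ↔ cs.bruhatLE y (star x⁻¹ z) := by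
  obtain ⟨ω, hω, rfl⟩ := cs.exists_isReduced x
  rw [← cs.wordProd_reverse]
  have hmin : cs.bruhatLE (rtr (cs.wordProd ω) y) z ↔
      cs.bruhatLE (ω.foldr cs.simpleMin y) z :=
    ⟨(hω.foldr_simpleMin_bruhatLE (hrtr _ y).1).trans,
      ((hrtr _ y).2 _ (hω.foldr_mem_lset cs.simpleMin_eq_or y)).trans⟩
  have hmax : cs.bruhatLE y (star (cs.wordProd ω.reverse) z) ↔
      cs.bruhatLE y (ω.reverse.foldr cs.simpleMax z) :=
    ⟨fun h => h.trans (hω.reverse.bruhatLE_foldr_simpleMax (hstar _ z).1),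
      fun h => h.trans ((hstar _ z).2 _ (hω.reverse.foldr_mem_lset cs.simpleMax_eq_or z))⟩
  rw [hmin, hmax, cs.foldr_simpleMin_bruhatLE_iff]
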